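/- Let d ≥ 3 and v : ℝ^d → ℝ be bounded, measurable, with bounded support. Then there exists α₀ > 0 such that for all x ∈ ℝ^d and all real α with |α| < α₀, E[exp(α ∫₀^∞ |v(W_x(s))| ds)] < ∞, where W_x is d-dimensional Brownian motion started at x. -/

import Mathlib

open MeasureTheory Real Filter Topology ProbabilityTheory

noncomputable section

/-- Euclidean space `ℝ^d`. -/
abbrev Euc (d : ℕ) := EuclideanSpace ℝ (Fin d)

/-- The Brownian transition density `q(s; w) = (2πs)^{-d/2} exp(-|w|²/(2s))`. -/
def heatKernel (d : ℕ) (s : ℝ) (w : Euc d) : ℝ :=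
  (2 * π * s) ^ (-(d : ℝ) / 2) * Real.exp (-‖w‖ ^ 2 / (2 * s))

/-- Joint density of a Brownian motion started at `x`, at times `s 0 < s 1 < ⋯`. -/
def jointDensity (d : ℕ) {k : ℕ} (x : Euc d) (s : Fin k → ℝ) (z : Fin k → Euc d) : ℝ :=
  ∏ j : Fin k,
    heatKernel d (s j - if (j : ℕ) = 0 then 0 else s ⟨(j : ℕ) - 1, lt_of_le_of_lt (Nat.sub_le _ _) j.isLt⟩)
      (z j - if (j : ℕ) = 0 then x else z ⟨(j : ℕ) - 1, lt_of_le_of_lt (Nat.sub_le _ _) j.isLt⟩)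

/-- Joint density of the Brownian bridge from `a` to `b` in time `t`, at interior times `s`. -/
def bridgeDensity (d : ℕ) {k : ℕ} (t : ℝ) (a b : Euc d) (s : Fin k → ℝ) (z : Fin k → Euc d) : ℝ :=
  jointDensity d a (Fin.snoc s t) (Fin.snoc z b) / heatKernel d t (b - a)

/-- The open ordered simplex `0 < s₁ < ⋯ < s_k < t`. -/
def simplex (k : ℕ) (t : ℝ) : Set (Fin k → ℝ) :=
  {s | StrictMono s ∧ ∀ i, 0 < s i ∧ s i < t}

/-- `W` is a standard `d`-dimensional Brownian motion started at `x`, characterized by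
continuous paths and finite-dimensional densities given by products of heat kernels. -/
def IsBrownianMotion {Ω : Type*} [MeasureSpace Ω] {d : ℕ} (x : Euc d)
    (W : ℝ → Ω → Euc d) : Prop :=
  (∀ ω, W 0 ω = x) ∧ (∀ ω, Continuous fun s => W s ω) ∧
  ∀ (k : ℕ) (s : Fin (k + 1) → ℝ), StrictMono s → (∀ i, 0 < s i) →
    Measure.map (fun ω (i : Fin (k + 1)) => W (s i) ω) (ℙ : Measure Ω) =
      (volume : Measure (Fin (k + 1) → Euc d)).withDensity
        (fun z => ENNReal.ofReal (jointDensity d x s z))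

/-- `X` is a `d`-dimensional Brownian bridge from `a` to `b` in time `t`. -/
def IsBrownianBridge {Ω : Type*} [MeasureSpace Ω] {d : ℕ} (t : ℝ) (a b : Euc d)
    (X : ℝ → Ω → Euc d) : Prop :=
  (∀ ω, X 0 ω = a) ∧ (∀ ω, X t ω = b) ∧
  (∀ ω, ContinuousOn (fun s => X s ω) (Set.Icc 0 t)) ∧
  ∀ (k : ℕ) (s : Fin (k + 1) → ℝ), StrictMono s → (∀ i, 0 < s i ∧ s i < t) →
    Measure.map (fun ω (i : Fin (k + 1)) => X (s i) ω) (ℙ : Measure Ω) =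
      (volume : Measure (Fin (k + 1) → Euc d)).withDensity
        (fun z => ENNReal.ofReal (bridgeDensity d t a b s z))

/-- The path integral `∫₀^t v(X_s) ds`. -/
def pathInt {Ω : Type*} {d : ℕ} (v : Euc d → ℝ) (X : ℝ → Ω → Euc d) (t : ℝ) (ω : Ω) : ℝ :=
  ∫ s in Set.Ioc (0 : ℝ) t, v (X s ω)

/-- The total path integral `∫₀^∞ v(X_s) ds`. -/
def pathIntInf {Ω : Type*} {d : ℕ} (v : Euc d → ℝ) (X : ℝ → Ω → Euc d) (ω : Ω) : ℝ :=
  ∫ s in Set.Ioi (0 : ℝ), v (X s ω)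

/-- The density ratio `Q_{j} = q(t; y - x)/q(Δ_j s; Δ_j z)` with the conventions
`s₀ = 0`, `s_{k+1} = t`, `z₀ = x`, `z_{k+1} = y`. -/
def Qratio (d : ℕ) {k : ℕ} (t : ℝ) (x y : Euc d) (s : Fin k → ℝ) (z : Fin k → Euc d)
    (j : Fin (k + 1)) : ℝ :=
  heatKernel d t (y - x) /
    heatKernel d
      ((Fin.cons 0 (Fin.snoc s t) : Fin (k + 2) → ℝ) j.succ -
        (Fin.cons 0 (Fin.snoc s t) : Fin (k + 2) → ℝ) j.castSucc)
      ((Fin.cons x (Fin.snoc z y) : Fin (k + 2) → Euc d) j.succ -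
        (Fin.cons x (Fin.snoc z y) : Fin (k + 2) → Euc d) j.castSucc)

open scoped ENNReal NNReal Nat

theorem lintegral_fin_snoc {E : Type*} [MeasureSpace E] [SigmaFinite (volume : Measure E)] {k : ℕ}
    {G : (Fin (k + 1) → E) → ℝ≥0∞} (hG : Measurable G) :
    ∫⁻ z, G z = ∫⁻ z : Fin k → E, ∫⁻ w, G (Fin.snoc z w : Fin (k + 1) → E) := by
  have hp := (volume_preserving_piFinSuccAbove (fun _ : Fin (k + 1) => E) (Fin.last k)).symm
  rw [hp.lintegral_map_equiv, Measure.volume_eq_prod, lintegral_prod_symm]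
  · simp [MeasurableEquiv.piFinSuccAbove_symm_apply, Fin.insertNthEquiv]
  · exact (hG.comp (MeasurableEquiv.measurable _)).aemeasurable

theorem measurable_fin_snoc {E : Type*} [MeasurableSpace E] {k : ℕ} :
    Measurable fun p : (Fin k → E) × E => (Fin.snoc p.1 p.2 : Fin (k + 1) → E) := by
  refine measurable_pi_lambda _ fun i => ?_
  induction i using Fin.lastCases with
  | last => simpa using measurable_snd
  | cast i => simpa [Function.comp_def] using (measurable_pi_apply i).comp measurable_fst

theorem lintegral_fin_prod_eq_pow {E : Type*} [MeasureSpace E] [SigmaFinite (volume : Measure E)]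
    {h : E → ℝ≥0∞} (hh : Measurable h) (k : ℕ) :
    ∫⁻ s : Fin k → E, ∏ i, h (s i) = (∫⁻ t, h t) ^ k := by
  induction k with
  | zero => simp [volume_pi]
  | succ k ih =>
    rw [lintegral_fin_snoc (by fun_prop)]
    simp only [Fin.prod_univ_castSucc, Fin.snoc_castSucc, Fin.snoc_last]
    simp_rw [lintegral_const_mul _ hh]
    rw [lintegral_mul_const _ (by fun_prop), ih, pow_succ]

theorem ae_injective_fin (k : ℕ) : ∀ᵐ s : Fin k → ℝ, Function.Injective s := by
  have key : ∀ i j : Fin k, ∀ᵐ s : Fin k → ℝ, s i = s j → i = j := by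
    intro i j
    by_cases hij : i = j
    · simp [hij]
    let L : (Fin k → ℝ) →ₗ[ℝ] ℝ := (LinearMap.proj i : (Fin k → ℝ) →ₗ[ℝ] ℝ) - LinearMap.proj j
    have hL : LinearMap.ker L ≠ ⊤ := by
      intro h
      have := LinearMap.mem_ker.1 (h ▸ Submodule.mem_top : Pi.single i 1 ∈ LinearMap.ker L)
      simp [L, Ne.symm hij] at this
    have h0 := Measure.addHaar_submodule volume (LinearMap.ker L) hL
    rw [ae_iff]
    refine measure_mono_null (fun s hs => ?_) h0
    simp only [Set.mem_ofPred_eq, Classical.not_imp] at hs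
    simp [L, hs.1]
  filter_upwards [ae_all_iff.2 fun i => ae_all_iff.2 (key i)] with s hs i j h using hs i j h

theorem measurableSet_strictMono (k : ℕ) : MeasurableSet {s : Fin k → ℝ | StrictMono s} := by
  simp only [StrictMono, Set.ofPred_forall]
  exact .iInter fun i => .iInter fun j => .iInter fun _ =>
    measurableSet_lt (measurable_pi_apply i) (measurable_pi_apply j)

theorem lintegral_pow_le_factorial_mul {h : ℝ → ℝ≥0∞} (hh : Measurable h) (k : ℕ) :
    (∫⁻ t, h t) ^ k ≤ k ! * ∫⁻ s in {s : Fin k → ℝ | StrictMono s}, ∏ i, h (s i) := by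
  rw [← lintegral_fin_prod_eq_pow hh k]
  set S := {s : Fin k → ℝ | StrictMono s}
  have hS : MeasurableSet S := measurableSet_strictMono k
  let T : Equiv.Perm (Fin k) → Set (Fin k → ℝ) := fun σ => {s | s ∘ σ ∈ S}
  have hcov : ∀ᵐ s : Fin k → ℝ, s ∈ ⋃ σ, T σ := by
    filter_upwards [ae_injective_fin k] with s hs
    exact Set.mem_iUnion.2 ⟨Tuple.sort s,
      (Tuple.monotone_sort s).strictMono_of_injective (hs.comp (Tuple.sort s).injective)⟩
  have hT : ∀ σ, ∫⁻ s in T σ, ∏ i, h (s i) = ∫⁻ s in S, ∏ i, h (s i) := by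
    intro σ
    have hp := volume_measurePreserving_piCongrLeft (fun _ : Fin k => ℝ) σ.symm
    have happ : ∀ s : Fin k → ℝ,
        MeasurableEquiv.piCongrLeft (fun _ : Fin k => ℝ) σ.symm s = s ∘ σ := by
      intro s
      ext i
      simp [MeasurableEquiv.coe_piCongrLeft, Equiv.piCongrLeft_apply]
    have := hp.setLIntegral_comp_preimage hS (f := fun s => ∏ i, h (s i)) (by fun_prop)
    rw [← this]
    have hpre : MeasurableEquiv.piCongrLeft (fun _ : Fin k => ℝ) σ.symm ⁻¹' S = T σ := by
      ext s
      simp [T, happ]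
    rw [hpre]
    refine lintegral_congr fun s => ?_
    rw [happ]
    exact (Equiv.prod_comp σ fun i => h (s i)).symm
  calc ∫⁻ s : Fin k → ℝ, ∏ i, h (s i)
      = ∫⁻ s in ⋃ σ, T σ, ∏ i, h (s i) := by
        rw [Measure.restrict_eq_self_of_ae_mem hcov]
    _ ≤ ∑' σ, ∫⁻ s in T σ, ∏ i, h (s i) := lintegral_iUnion_le _ _
    _ = k ! * ∫⁻ s in S, ∏ i, h (s i) := by
        simp [hT, tsum_fintype, Fintype.card_perm]

theorem measurable_heatKernel {d : ℕ} :
    Measurable fun p : ℝ × Euc d => heatKernel d p.1 p.2 := by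
  unfold heatKernel
  fun_prop

theorem measurable_jointDensity {d k : ℕ} (x : Euc d) :
    Measurable fun p : (Fin k → ℝ) × (Fin k → Euc d) => jointDensity d x p.1 p.2 := by
  unfold jointDensity
  refine Finset.measurable_prod _ fun j _ => ?_
  split_ifs
  · exact measurable_heatKernel.comp (f := fun p : (Fin k → ℝ) × (Fin k → Euc d) =>
      (p.1 j - 0, p.2 j - x)) (by fun_prop)
  · exact measurable_heatKernel.comp (f := fun p : (Fin k → ℝ) × (Fin k → Euc d) =>
      (p.1 j - p.1 ⟨(j : ℕ) - 1, _⟩, p.2 j - p.2 ⟨(j : ℕ) - 1, _⟩)) (by fun_prop)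

theorem heatKernel_pos {d : ℕ} {s : ℝ} (hs : 0 < s) (w : Euc d) : 0 < heatKernel d s w := by
  unfold heatKernel
  positivity

theorem jointDensity_pos {d k : ℕ} (x : Euc d) {s : Fin k → ℝ} (hs : StrictMono s)
    (h0 : ∀ i, 0 < s i) (z : Fin k → Euc d) : 0 < jointDensity d x s z := by
  refine Finset.prod_pos fun j _ => heatKernel_pos ?_ _
  split_ifs with hj
  · simpa using h0 j
  · exact sub_pos.2 (hs (Fin.lt_def.2 (by simp; omega)))

theorem exists_jointDensity_snoc {d k : ℕ} (x : Euc d) (s : Fin k → ℝ) :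
    ∃ (T : ℝ) (Z : (Fin k → Euc d) → Euc d), Measurable Z ∧
      (∀ t, StrictMono (Fin.snoc s t : Fin (k + 1) → ℝ) →
        (∀ i, 0 < (Fin.snoc s t : Fin (k + 1) → ℝ) i) → T < t) ∧
      ∀ t z w, jointDensity d x (Fin.snoc s t : Fin (k + 1) → ℝ)
          (Fin.snoc z w : Fin (k + 1) → Euc d) =
        jointDensity d x s z * heatKernel d (t - T) (w - Z z) := by
  cases k with
  | zero =>
    refine ⟨0, fun _ => x, measurable_const, fun t _ h => ?_, fun t z w => ?_⟩
    · simpa [Fin.snoc] using h 0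
    · simp [jointDensity, Fin.snoc]
  | succ k =>
    refine ⟨s (Fin.last k), fun z => z (Fin.last k), measurable_pi_apply _, fun t h _ => ?_,
      fun t z w => ?_⟩
    · simpa using h (Fin.castSucc_lt_last (Fin.last k))
    · have hsnoc : ∀ {E : Type} (u : Fin (k + 1) → E) (e : E) (n : ℕ) (hn : n < k + 1)
          (hn' : n < k + 1 + 1), (Fin.snoc u e : Fin (k + 1 + 1) → E) ⟨n, hn'⟩ = u ⟨n, hn⟩ :=
        fun u e n hn _ => Fin.snoc_castSucc (α := fun _ => _) e u ⟨n, hn⟩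
      unfold jointDensity
      rw [Fin.prod_univ_castSucc]
      congr 1
      · refine Finset.prod_congr rfl fun j _ => ?_
        have hj : (j : ℕ) - 1 < k + 1 := by omega
        simp only [Fin.snoc_castSucc, Fin.val_castSucc, hsnoc _ _ _ hj]
      · simp only [Fin.snoc_last, Fin.val_last, Nat.add_sub_cancel, hsnoc _ _ k k.lt_succ_self]
        rfl

theorem lintegral_heatKernel {d : ℕ} {s : ℝ} (hs : 0 < s) :
    ∫⁻ w : Euc d, ENNReal.ofReal (heatKernel d s w) = 1 := by
  have h := GaussianFourier.integral_rexp_neg_mul_sq_norm (V := Euc d) (b := 1 / (2 * s))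
    (by positivity)
  have hint : Integrable fun w : Euc d => rexp (-(1 / (2 * s)) * ‖w‖ ^ 2) := by
    by_contra hc
    rw [integral_undef hc] at h
    have : 0 < (π / (1 / (2 * s))) ^ ((Module.finrank ℝ (Euc d) : ℝ) / 2) := by positivity
    exact this.ne h
  have heq : heatKernel d s =
      fun w => (2 * π * s) ^ (-(d : ℝ) / 2) * rexp (-(1 / (2 * s)) * ‖w‖ ^ 2) := by
    ext w
    unfold heatKernel
    ring_nf
  rw [← ofReal_integral_eq_lintegral_ofReal]
  · rw [heq, integral_const_mul, h, finrank_euclideanSpace_fin,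
      show π / (1 / (2 * s)) = 2 * π * s by field_simp, ← Real.rpow_add (by positivity)]
    simp [neg_div]
  · rw [heq]
    exact hint.const_mul _
  · exact ae_of_all _ fun w => (heatKernel_pos hs w).le

theorem exists_potential_bound {d : ℕ} (hd : 3 ≤ d) {v : Euc d → ℝ} (hvm : Measurable v)
    (hvb : ∃ C : ℝ, ∀ z, |v z| ≤ C) (hvs : ∃ R : ℝ, ∀ z, v z ≠ 0 → ‖z‖ ≤ R) :
    ∃ K : ℝ≥0, ∀ y : Euc d, ∫⁻ s in Set.Ioi (0 : ℝ), ∫⁻ z,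
      ENNReal.ofReal (heatKernel d s (z - y)) * ‖v z‖ₑ ≤ K := by
  obtain ⟨C, hC⟩ := hvb
  obtain ⟨R, hR⟩ := hvs
  have hC' : ∀ z, ‖v z‖ₑ ≤ ENNReal.ofReal C := fun z => by
    rw [Real.enorm_eq_ofReal_abs]
    exact ENNReal.ofReal_le_ofReal (hC z)
  have hsmall : ∀ (y : Euc d), ∀ s ∈ Set.Ioc (0 : ℝ) 1, ∫⁻ z,
      ENNReal.ofReal (heatKernel d s (z - y)) * ‖v z‖ₑ ≤ ENNReal.ofReal C := by
    intro y s hs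
    calc _ ≤ ∫⁻ z, ENNReal.ofReal (heatKernel d s (z - y)) * ENNReal.ofReal C := by
          gcongr with z
          exact hC' z
      _ = ENNReal.ofReal C := by
          rw [lintegral_mul_const' _ _ ENNReal.ofReal_ne_top,
            lintegral_sub_right_eq_self (fun w => ENNReal.ofReal (heatKernel d s w)),
            lintegral_heatKernel hs.1, one_mul]
  have hnorm : ∫⁻ z, ‖v z‖ₑ ≠ ⊤ := by
    have : ∫⁻ z, ‖v z‖ₑ ≤ ∫⁻ z in Metric.closedBall (0 : Euc d) R, ENNReal.ofReal C := by
      rw [← lintegral_indicator measurableSet_closedBall]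
      refine lintegral_mono fun z => ?_
      by_cases hz : v z = 0
      · simp [hz]
      · rw [Set.indicator_of_mem (by simpa using hR z hz)]
        exact hC' z
    refine ne_top_of_le_ne_top ?_ this
    rw [setLIntegral_const]
    exact ENNReal.mul_ne_top ENNReal.ofReal_ne_top measure_closedBall_lt_top.ne
  have hlarge : ∀ (y : Euc d), ∀ s ∈ Set.Ioi (1 : ℝ), ∫⁻ z,
      ENNReal.ofReal (heatKernel d s (z - y)) * ‖v z‖ₑ ≤
        ENNReal.ofReal ((2 * π) ^ (-(d : ℝ) / 2) * s ^ (-(d : ℝ) / 2)) * ∫⁻ z, ‖v z‖ₑ := by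
    intro y s hs
    have hs0 : (0 : ℝ) < s := one_pos.trans hs
    rw [← lintegral_const_mul _ hvm.enorm]
    gcongr with z
    rw [← Real.mul_rpow (by positivity) hs0.le]
    refine mul_le_of_le_one_right (by positivity) (Real.exp_le_one_iff.2 ?_)
    rw [neg_div]
    exact neg_nonpos.2 (by positivity)
  have hint : IntegrableOn (fun s : ℝ => (2 * π) ^ (-(d : ℝ) / 2) * s ^ (-(d : ℝ) / 2))
      (Set.Ioi 1) := by
    refine Integrable.const_mul (integrableOn_Ioi_rpow_of_lt ?_ one_pos) _
    have : (3 : ℝ) ≤ d := by exact_mod_cast hd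
    linarith
  set K : ℝ≥0∞ := ENNReal.ofReal C + (∫⁻ s in Set.Ioi (1 : ℝ),
    ENNReal.ofReal ((2 * π) ^ (-(d : ℝ) / 2) * s ^ (-(d : ℝ) / 2))) * ∫⁻ z, ‖v z‖ₑ
  have hK : K ≠ ⊤ := by
    refine ENNReal.add_ne_top.2 ⟨ENNReal.ofReal_ne_top, ENNReal.mul_ne_top ?_ hnorm⟩
    exact hint.lintegral_lt_top.ne
  refine ⟨K.toNNReal, fun y => ?_⟩
  rw [ENNReal.coe_toNNReal hK, ← Set.Ioc_union_Ioi_eq_Ioi zero_le_one]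
  refine (lintegral_union_le _ _ _).trans (add_le_add ?_ ?_)
  · refine (setLIntegral_mono' measurableSet_Ioc (hsmall y)).trans ?_
    simp
  · refine (setLIntegral_mono' measurableSet_Ioi (hlarge y)).trans ?_
    rw [lintegral_mul_const' _ _ hnorm]

theorem lintegral_lintegral_mul_le {α β : Type*} [MeasurableSpace α] [MeasurableSpace β]
    {μ : Measure α} {ν : Measure β} [SFinite μ] [SFinite ν] {a : β → ℝ≥0∞} {b : α → β → ℝ≥0∞}
    (ha : Measurable a) (hb : Measurable (Function.uncurry b)) {K : ℝ≥0∞}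
    (hK : ∀ z, ∫⁻ t, b t z ∂μ ≤ K) :
    ∫⁻ t, ∫⁻ z, a z * b t z ∂ν ∂μ ≤ (∫⁻ z, a z ∂ν) * K := by
  calc ∫⁻ t, ∫⁻ z, a z * b t z ∂ν ∂μ = ∫⁻ z, ∫⁻ t, a z * b t z ∂μ ∂ν :=
        lintegral_lintegral_swap ((ha.comp measurable_snd).mul hb).aemeasurable
    _ = ∫⁻ z, a z * ∫⁻ t, b t z ∂μ ∂ν :=
        lintegral_congr fun z => lintegral_const_mul _ (hb.comp measurable_prodMk_right)
    _ ≤ ∫⁻ z, a z * K ∂ν := by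
        gcongr with z
        exact hK z
    _ = _ := lintegral_mul_const _ ha

/-- Strictly increasing `k`-tuples of positive times. -/
def orderedTimes (k : ℕ) : Set (Fin k → ℝ) :=
  {s | StrictMono s ∧ ∀ i, 0 < s i}

theorem measurableSet_orderedTimes (k : ℕ) : MeasurableSet (orderedTimes k) := by
  have hpos : MeasurableSet {s : Fin k → ℝ | ∀ i, 0 < s i} := by
    rw [Set.ofPred_forall]
    exact .iInter fun i => measurableSet_lt measurable_const (measurable_pi_apply i)
  exact (measurableSet_strictMono k).inter hpos

theorem lintegral_jointDensity_mul_prod_le {d : ℕ} {f : Euc d → ℝ≥0∞} (hf : Measurable f)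
    {K : ℝ≥0} (hK : ∀ y : Euc d, ∫⁻ s in Set.Ioi (0 : ℝ), ∫⁻ z,
      ENNReal.ofReal (heatKernel d s (z - y)) * f z ≤ K) (x : Euc d) (k : ℕ) :
    ∫⁻ s in orderedTimes k,
      ∫⁻ z, ENNReal.ofReal (jointDensity d x s z) * ∏ i, f (z i) ≤ (K : ℝ≥0∞) ^ k := by
  have hS := measurableSet_orderedTimes
  have hΦ : ∀ k, Measurable fun s : Fin k → ℝ =>
      ∫⁻ z, ENNReal.ofReal (jointDensity d x s z) * ∏ i, f (z i) := fun k =>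
    Measurable.lintegral_prod_right' (f := fun p : (Fin k → ℝ) × (Fin k → Euc d) =>
      ENNReal.ofReal (jointDensity d x p.1 p.2) * ∏ i, f (p.2 i))
      ((measurable_jointDensity x).ennreal_ofReal.mul (by fun_prop))
  induction k with
  | zero => simp [volume_pi, jointDensity, StrictMono, orderedTimes]
  | succ k ih =>
    rw [← lintegral_indicator (hS _), lintegral_fin_snoc ((hΦ _).indicator (hS _))]
    have step : ∀ s : Fin k → ℝ, ∫⁻ t : ℝ,
        (orderedTimes (k + 1)).indicator (fun s =>
          ∫⁻ z, ENNReal.ofReal (jointDensity d x s z) * ∏ i, f (z i)) (Fin.snoc s t) ≤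
        (orderedTimes k).indicator (fun s =>
          ∫⁻ z, ENNReal.ofReal (jointDensity d x s z) * ∏ i, f (z i)) s * K := by
      intro s
      by_cases hs : StrictMono s ∧ ∀ i, 0 < s i
      · rw [Set.indicator_of_mem (show s ∈ orderedTimes k from hs)]
        obtain ⟨T, Z, hZ, hT, hj⟩ := exists_jointDensity_snoc x s
        set a : (Fin k → Euc d) → ℝ≥0∞ := fun z =>
          ENNReal.ofReal (jointDensity d x s z) * ∏ i, f (z i) with ha
        have ham : Measurable a :=
          ((measurable_jointDensity x).comp measurable_prodMk_left).ennreal_ofReal.mul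
            (by fun_prop)
        let b : ℝ → (Fin k → Euc d) → ℝ≥0∞ := fun t z =>
          ∫⁻ w, ENNReal.ofReal (heatKernel d (t - T) (w - Z z)) * f w
        have hbm : Measurable (Function.uncurry b) :=
          Measurable.lintegral_prod_right' (f := fun p : (ℝ × (Fin k → Euc d)) × Euc d =>
            ENNReal.ofReal (heatKernel d (p.1.1 - T) (p.2 - Z p.1.2)) * f p.2)
            (((measurable_heatKernel (d := d)).comp
              (f := fun p : (ℝ × (Fin k → Euc d)) × Euc d => (p.1.1 - T, p.2 - Z p.1.2))
              (by fun_prop)).ennreal_ofReal.mul (by fun_prop))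
        have hkm : ∀ t z, Measurable fun w =>
            ENNReal.ofReal (heatKernel d (t - T) (w - Z z)) * f w := fun t z =>
          ((measurable_heatKernel (d := d)).comp
            (f := fun w : Euc d => (t - T, w - Z z)) (by fun_prop)).ennreal_ofReal.mul hf
        have hb : ∀ z, ∫⁻ t in Set.Ioi T, b t z ≤ K := by
          intro z
          refine le_trans (le_of_eq ?_) (hK (Z z))
          rw [← lintegral_indicator measurableSet_Ioi, ← lintegral_indicator measurableSet_Ioi,
            ← lintegral_sub_right_eq_self ((Set.Ioi 0).indicator _) T]
          refine lintegral_congr fun t => ?_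
          simp [Set.indicator_apply, b]
        calc _ ≤ ∫⁻ t in Set.Ioi T, ∫⁻ z, a z * b t z := by
              rw [← lintegral_indicator measurableSet_Ioi]
              refine lintegral_mono fun t => ?_
              by_cases ht : (Fin.snoc s t : Fin (k + 1) → ℝ) ∈ orderedTimes (k + 1)
              · rw [Set.indicator_of_mem ht, Set.indicator_of_mem (Set.mem_Ioi.2 (hT t ht.1 ht.2)),
                  lintegral_fin_snoc]
                · refine le_of_eq (lintegral_congr fun z => ?_)
                  rw [← lintegral_const_mul _ (hkm t z)]
                  refine lintegral_congr fun w => ?_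
                  rw [hj, ENNReal.ofReal_mul (jointDensity_pos x hs.1 hs.2 z).le,
                    Fin.prod_univ_castSucc]
                  simp only [Fin.snoc_castSucc, Fin.snoc_last, ha]
                  ring
                · exact ((measurable_jointDensity x).comp
                    measurable_prodMk_left).ennreal_ofReal.mul (by fun_prop)
              · rw [Set.indicator_of_notMem ht]
                exact zero_le
          _ ≤ (∫⁻ z, a z) * K := lintegral_lintegral_mul_le ham hbm hb
      · refine le_of_eq_of_le ?_ zero_le
        rw [lintegral_eq_zero_of_ae_eq_zero]
        refine ae_of_all _ fun t => Set.indicator_of_notMem (fun h => hs ⟨?_, ?_⟩) _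
        · intro i j hij
          simpa using h.1 (Fin.castSucc_lt_castSucc_iff.2 hij)
        · intro i
          simpa using h.2 i.castSucc
    refine (lintegral_mono step).trans ?_
    rw [lintegral_mul_const _ ((hΦ k).indicator (hS k)), lintegral_indicator (hS k), pow_succ]
    gcongr

section BrownianMotion

variable {Ω : Type*} [MeasureSpace Ω] {d : ℕ} {x : Euc d} {W : ℝ → Ω → Euc d}

theorem IsBrownianMotion.aemeasurable (hW : IsBrownianMotion x W) {s : ℝ} (hs : 0 < s) :
    AEMeasurable (W s) := by
  have hmono : StrictMono fun _ : Fin (0 + 1) => s := fun i j h => by omega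
  have hmap := hW.2.2 0 (fun _ => s) hmono (fun _ => hs)
  have hne : Measure.map (fun ω (_ : Fin 1) => W s ω) (ℙ : Measure Ω) ≠ 0 := by
    rw [hmap]
    intro h
    have hm : Measurable fun z : Fin 1 → Euc d =>
        ENNReal.ofReal (jointDensity d x (fun _ => s) z) :=
      ((measurable_jointDensity x).comp measurable_prodMk_left).ennreal_ofReal
    obtain ⟨z, hz⟩ := ((withDensity_eq_zero_iff hm.aemeasurable).1 h).exists
    exact (jointDensity_pos x hmono (fun _ => hs) z).not_ge
      (ENNReal.ofReal_eq_zero.1 hz)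
  exact (measurable_pi_apply (0 : Fin 1)).comp_aemeasurable (AEMeasurable.of_map_ne_zero hne)

theorem IsBrownianMotion.exists_measurable_modification (hW : IsBrownianMotion x W) :
    ∃ W' : ℝ → Ω → Euc d, Measurable (Function.uncurry W') ∧
      ∀ᵐ ω, ∀ s, 0 < s → W' s ω = W s ω := by
  have hae : ∀ q : {q : ℚ // 0 < q}, AEMeasurable (W (q : ℚ)) := fun q =>
    hW.aemeasurable (Rat.cast_pos.2 q.2)
  have hall : ∀ᵐ ω, ∀ q : {q : ℚ // 0 < q}, W (q : ℚ) ω = (hae q).mk _ ω :=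
    ae_all_iff.2 fun q => (hae q).ae_eq_mk
  obtain ⟨N, hNsub, hNm, hN⟩ := exists_measurable_superset_of_null hall
  obtain ⟨G, hGm, hG, hGsub⟩ : ∃ G : Set Ω, MeasurableSet G ∧ (∀ᵐ ω, ω ∈ G) ∧
      ∀ ω ∈ G, ∀ q : {q : ℚ // 0 < q}, W (q : ℚ) ω = (hae q).mk _ ω :=
    ⟨Nᶜ, hNm.compl, compl_mem_ae_iff.2 hN, fun ω hω => not_not.1 fun h => hω (hNsub h)⟩
  classical
  let W' : ℝ → Ω → Euc d := fun s => G.piecewise (W |s|) fun _ => x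
  have hq : ∀ q : ℚ, 0 < q → Measurable (W' q) := by
    intro q hq
    have : W' q = G.piecewise ((hae ⟨q, hq⟩).mk _) fun _ => x := by
      ext1 ω
      by_cases hω : ω ∈ G
      · have hq' : |(q : ℝ)| = q := abs_of_pos (Rat.cast_pos.2 hq)
        simp only [W', Set.piecewise_eq_of_mem _ _ _ hω, hq']
        exact hGsub ω hω ⟨q, hq⟩
      · simp [W', hω]
    rw [this]
    exact (hae ⟨q, hq⟩).measurable_mk.piecewise hGm measurable_const
  have hcont : ∀ ω, Continuous fun s => W' s ω := by
    intro ω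
    by_cases hω : ω ∈ G
    · simpa [W', hω, Function.comp_def] using (hW.2.1 ω).comp continuous_abs
    · simpa [W', hω] using continuous_const
  refine ⟨W', measurable_uncurry_of_continuous_of_measurable hcont fun s => ?_, ?_⟩
  · have hex : ∀ n : ℕ, ∃ q : ℚ, |s| < q ∧ (q : ℝ) < |s| + 1 / ((n : ℝ) + 1) := fun n =>
      exists_rat_btwn (lt_add_of_pos_right _ (by positivity))
    choose q hq1 hq2 using hex
    have hlim : Tendsto (fun n => (q n : ℝ)) atTop (𝓝 |s|) := by
      refine tendsto_of_tendsto_of_tendsto_of_le_of_le tendsto_const_nhds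
        (by simpa using tendsto_one_div_add_atTop_nhds_zero_nat.const_add |s|)
        (fun n => (hq1 n).le) (fun n => (hq2 n).le)
    have habs : W' s = W' |s| := by simp [W']
    rw [habs]
    refine measurable_of_tendsto_metrizable
      (fun n => hq (q n) (Rat.cast_pos.1 ((abs_nonneg s).trans_lt (hq1 n))))
      (tendsto_pi_nhds.2 fun ω => ((hcont ω).tendsto _).comp hlim)
  · filter_upwards [hG] with ω hω s hs
    simp [W', hω, abs_of_pos hs]

theorem IsBrownianMotion.lintegral_prod (hW : IsBrownianMotion x W) {f : Euc d → ℝ≥0∞}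
    (hf : Measurable f) {k : ℕ} {s : Fin (k + 1) → ℝ} (hs : StrictMono s) (h0 : ∀ i, 0 < s i) :
    ∫⁻ ω, ∏ i, f (W (s i) ω) =
      ∫⁻ z, ENNReal.ofReal (jointDensity d x s z) * ∏ i, f (z i) := by
  have hm : Measurable fun z : Fin (k + 1) → Euc d => ENNReal.ofReal (jointDensity d x s z) :=
    ((measurable_jointDensity x).comp measurable_prodMk_left).ennreal_ofReal
  have hg : Measurable fun z : Fin (k + 1) → Euc d => ∏ i, f (z i) := by fun_prop
  have hWm : AEMeasurable fun ω i => W (s i) ω :=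
    aemeasurable_pi_lambda _ fun i => hW.aemeasurable (h0 i)
  rw [← lintegral_map' (f := fun z : Fin (k + 1) → Euc d => ∏ i, f (z i))
    hg.aemeasurable hWm, hW.2.2 k s hs h0, lintegral_withDensity_eq_lintegral_mul _ hm hg]
  rfl

theorem IsBrownianMotion.lintegral_pow_le [IsProbabilityMeasure (ℙ : Measure Ω)]
    (hW : IsBrownianMotion x W) {f : Euc d → ℝ≥0∞} (hf : Measurable f)
    {K : ℝ≥0} (hK : ∀ y : Euc d, ∫⁻ s in Set.Ioi (0 : ℝ), ∫⁻ z,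
      ENNReal.ofReal (heatKernel d s (z - y)) * f z ≤ K) (k : ℕ) :
    ∫⁻ ω, (∫⁻ s in Set.Ioi (0 : ℝ), f (W s ω)) ^ k ≤ k ! * (K : ℝ≥0∞) ^ k := by
  cases k with
  | zero => simp
  | succ k =>
  obtain ⟨W', hW'm, hW'⟩ := hW.exists_measurable_modification
  let h : Ω → ℝ → ℝ≥0∞ := fun ω => (Set.Ioi 0).indicator fun s => f (W' s ω)
  have hh : Measurable (Function.uncurry h) := by
    have : Function.uncurry h =
        {p : Ω × ℝ | 0 < p.2}.indicator fun p => f (W' p.2 p.1) := by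
      ext p
      simp [h, Function.uncurry, Set.indicator_apply]
    rw [this]
    exact (hf.comp (hW'm.comp measurable_swap)).indicator
      (measurableSet_lt measurable_const measurable_snd)
  calc ∫⁻ ω, (∫⁻ s in Set.Ioi (0 : ℝ), f (W s ω)) ^ (k + 1)
      = ∫⁻ ω, (∫⁻ s, h ω s) ^ (k + 1) := by
        refine lintegral_congr_ae ?_
        filter_upwards [hW'] with ω hω
        rw [lintegral_indicator measurableSet_Ioi]
        congr 1
        exact setLIntegral_congr_fun measurableSet_Ioi fun s hs => by rw [hω s hs]
    _ ≤ ∫⁻ ω, (k + 1)! * ∫⁻ s in {s : Fin (k + 1) → ℝ | StrictMono s}, ∏ i, h ω (s i) :=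
        lintegral_mono fun ω => lintegral_pow_le_factorial_mul
          (hh.comp measurable_prodMk_left) _
    _ = (k + 1)! * ∫⁻ s in {s : Fin (k + 1) → ℝ | StrictMono s}, ∫⁻ ω, ∏ i, h ω (s i) := by
        rw [lintegral_const_mul' _ _ (ENNReal.natCast_ne_top _), lintegral_lintegral_swap]
        refine (Finset.measurable_prod _ fun i _ => ?_).aemeasurable
        exact hh.comp (f := fun p : Ω × (Fin (k + 1) → ℝ) => (p.1, p.2 i)) (by fun_prop)
    _ ≤ (k + 1)! * ∫⁻ s in orderedTimes (k + 1),
          ∫⁻ z, ENNReal.ofReal (jointDensity d x s z) * ∏ i, f (z i) := by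
        rw [← lintegral_indicator (measurableSet_strictMono _),
          ← lintegral_indicator (measurableSet_orderedTimes _)]
        gcongr with s
        by_cases hs : StrictMono s
        · rw [Set.indicator_of_mem (show s ∈ {s | StrictMono s} from hs)]
          by_cases h0 : ∀ i, 0 < s i
          · rw [Set.indicator_of_mem (show s ∈ orderedTimes (k + 1) from ⟨hs, h0⟩),
              ← hW.lintegral_prod hf hs h0]
            refine le_of_eq (lintegral_congr_ae ?_)
            filter_upwards [hW'] with ω hω
            refine Finset.prod_congr rfl fun i _ => ?_
            simp [h, h0 i, hω _ (h0 i)]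
          · obtain ⟨i, hi⟩ := not_forall.1 h0
            refine le_of_eq_of_le ?_ zero_le
            have : ∀ ω, ∏ i, h ω (s i) = 0 := fun ω =>
              Finset.prod_eq_zero (Finset.mem_univ i) (Set.indicator_of_notMem (by simpa using hi) _)
            simp [this]
        · rw [Set.indicator_of_notMem (show s ∉ {s | StrictMono s} from hs)]
          exact zero_le
    _ ≤ (k + 1)! * (K : ℝ≥0∞) ^ (k + 1) := by
        gcongr
        exact lintegral_jointDensity_mul_prod_le hf hK x (k + 1)

end BrownianMotion

theorem ofReal_exp_mul_integral_le_tsum (α : ℝ) (g : ℝ → ℝ) (S : Set ℝ) :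
    ENNReal.ofReal (rexp (α * ∫ s in S, |g s|)) ≤
      ∑' k : ℕ, ENNReal.ofReal (|α| ^ k / k !) * (∫⁻ s in S, ‖g s‖ₑ) ^ k := by
  set I := ∫ s in S, |g s|
  have hI0 : 0 ≤ I := integral_nonneg fun _ => abs_nonneg _
  have hI : ENNReal.ofReal I ≤ ∫⁻ s in S, ‖g s‖ₑ := by
    have := enorm_integral_le_lintegral_enorm (μ := volume.restrict S) fun s => |g s|
    simpa [Real.enorm_eq_ofReal_abs, abs_of_nonneg hI0, I] using this
  have hsum := NormedSpace.expSeries_div_hasSum_exp (|α| * I)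
  rw [← Real.exp_eq_exp_ℝ] at hsum
  calc ENNReal.ofReal (rexp (α * I)) ≤ ENNReal.ofReal (rexp (|α| * I)) := by
        gcongr
        exact le_abs_self α
    _ = ∑' k : ℕ, ENNReal.ofReal (|α| ^ k / k !) * ENNReal.ofReal I ^ k := by
        rw [← hsum.tsum_eq, ENNReal.ofReal_tsum_of_nonneg (fun k => by positivity) hsum.summable]
        refine tsum_congr fun k => ?_
        rw [← ENNReal.ofReal_pow hI0, ← ENNReal.ofReal_mul (by positivity)]
        ring_nf
    _ ≤ _ := by gcongr

/-- Lemma 1: uniform exponential integrability of the total path integral of `|v|`. -/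
theorem stmt2 (d : ℕ) (hd : 3 ≤ d) (v : Euc d → ℝ)
    (hvm : Measurable v) (hvb : ∃ C : ℝ, ∀ z, |v z| ≤ C)
    (hvs : ∃ R : ℝ, ∀ z, v z ≠ 0 → ‖z‖ ≤ R)
    {Ω : Type*} [MeasureSpace Ω] [IsProbabilityMeasure (ℙ : Measure Ω)] :
    ∃ α₀ : ℝ, 0 < α₀ ∧ ∀ (x : Euc d) (W : ℝ → Ω → Euc d) (α : ℝ), |α| < α₀ →
      IsBrownianMotion x W →
      (∫⁻ ω, ENNReal.ofReal (Real.exp (α * ∫ s in Set.Ioi (0 : ℝ), |v (W s ω)|))) ≠ ⊤ := by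
  obtain ⟨K, hK⟩ := exists_potential_bound hd hvm hvb hvs
  refine ⟨1 / (K + 1), by positivity, fun x W α hα hW => ?_⟩
  have hαK : |α| * K < 1 := by
    have h1 := (lt_div_iff₀ (by positivity : (0 : ℝ) < K + 1)).1 hα
    nlinarith [abs_nonneg α]
  have hAm : AEMeasurable fun ω => ∫⁻ s in Set.Ioi (0 : ℝ), ‖v (W s ω)‖ₑ := by
    obtain ⟨W', hW'm, hW'⟩ := hW.exists_measurable_modification
    refine ⟨fun ω => ∫⁻ s in Set.Ioi (0 : ℝ), ‖v (W' s ω)‖ₑ,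
      Measurable.lintegral_prod_left' (f := fun p : ℝ × Ω => ‖v (W' p.1 p.2)‖ₑ)
        (hvm.comp hW'm).enorm, ?_⟩
    filter_upwards [hW'] with ω hω
    exact setLIntegral_congr_fun measurableSet_Ioi fun s hs => by rw [hω s hs]
  refine ne_top_of_le_ne_top ?_ (lintegral_mono fun ω =>
    ofReal_exp_mul_integral_le_tsum α (fun s => v (W s ω)) (Set.Ioi 0))
  rw [lintegral_tsum fun k => (hAm.pow_const k).const_mul _]
  have hterm : ∀ k : ℕ, ∫⁻ ω, ENNReal.ofReal (|α| ^ k / k !) *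
      (∫⁻ s in Set.Ioi (0 : ℝ), ‖v (W s ω)‖ₑ) ^ k ≤ ENNReal.ofReal ((|α| * K) ^ k) := by
    intro k
    rw [lintegral_const_mul' _ _ ENNReal.ofReal_ne_top]
    refine (mul_le_mul_right (hW.lintegral_pow_le hvm.enorm hK k) _).trans (le_of_eq ?_)
    rw [← ENNReal.ofReal_coe_nnreal, ← ENNReal.ofReal_natCast, ← ENNReal.ofReal_pow K.coe_nonneg,
      ← ENNReal.ofReal_mul (by positivity), ← ENNReal.ofReal_mul (by positivity), mul_pow]
    congr 1
    field_simp
  refine ne_top_of_le_ne_top ?_ (ENNReal.tsum_le_tsum hterm)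
  exact (summable_geometric_of_lt_one (by positivity) hαK).tsum_ofReal_ne_top

end
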